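/- arXiv:2605.07950 — 2 statements merged into one kernel-verified Lean document; each statement's English description precedes it below -/
import Mathlib

section
/- Let Φ : ℝ^d → ℝ be continuously differentiable with ⟨x - y, ∇Φ(x) - ∇Φ(y)⟩ ≥ m‖x - y‖² - b for all x, y (m > 0, b ≥ 0) and ‖∇Φ(x)‖ ≤ G + L‖x‖, and let X be distributed according to the Gibbs density proportional to e^{-Φ}. Then E[‖X - E[X]‖²] ≤ (2d + b)/(2m) and E[‖X - E[X]‖⁴] ≤ (2d + 4 + b)(2d + b)/m². -/
open MeasureTheory
open scoped InnerProductSpace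

/-- `f` is bounded in norm by a polynomial in the norm of its argument. -/
def HasPolyGrowth {E F : Type*} [NormedAddCommGroup E] [NormedAddCommGroup F] (f : E → F) : Prop :=
  ∃ (C : ℝ) (k : ℕ), ∀ x, ‖f x‖ ≤ C * (1 + ‖x‖) ^ k

namespace HasPolyGrowth

variable {E F G : Type*} [NormedAddCommGroup E] [NormedAddCommGroup F] [NormedAddCommGroup G]

theorem of_norm_le {f : E → F} {g : E → G} (hg : HasPolyGrowth g) (h : ∀ x, ‖f x‖ ≤ ‖g x‖) :
    HasPolyGrowth f := by
  obtain ⟨C, k, hC⟩ := hg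
  exact ⟨C, k, fun x => (h x).trans (hC x)⟩

theorem const (c : F) : HasPolyGrowth (fun _ : E => c) := ⟨‖c‖, 0, fun x => by simp⟩

theorem id : HasPolyGrowth (fun x : E => x) := ⟨1, 1, fun x => by simp⟩

theorem fst : HasPolyGrowth (fun p : E × F => p.1) :=
  of_norm_le id fun p => norm_fst_le p

theorem snd : HasPolyGrowth (fun p : E × F => p.2) :=
  of_norm_le id fun p => norm_snd_le p

theorem norm {f : E → F} (hf : HasPolyGrowth f) : HasPolyGrowth (fun x => ‖f x‖) :=
  of_norm_le hf fun x => by simp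

theorem exists_nonneg {f : E → F} (hf : HasPolyGrowth f) :
    ∃ (C : ℝ) (k : ℕ), 0 ≤ C ∧ ∀ x, ‖f x‖ ≤ C * (1 + ‖x‖) ^ k := by
  obtain ⟨C, k, h⟩ := hf
  refine ⟨|C|, k, abs_nonneg _, fun x => (h x).trans ?_⟩
  gcongr
  exact le_abs_self C

theorem add {f g : E → F} (hf : HasPolyGrowth f) (hg : HasPolyGrowth g) :
    HasPolyGrowth (fun x => f x + g x) := by
  obtain ⟨C, k, hC, h⟩ := hf.exists_nonneg
  obtain ⟨C', k', hC', h'⟩ := hg.exists_nonneg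
  refine ⟨C + C', k + k', fun x => (norm_add_le _ _).trans ?_⟩
  have h1 : (1 : ℝ) ≤ 1 + ‖x‖ := by simp
  have e1 : (1 + ‖x‖) ^ k ≤ (1 + ‖x‖) ^ (k + k') := pow_le_pow_right₀ h1 (by omega)
  have e2 : (1 + ‖x‖) ^ k' ≤ (1 + ‖x‖) ^ (k + k') := pow_le_pow_right₀ h1 (by omega)
  calc ‖f x‖ + ‖g x‖ ≤ C * (1 + ‖x‖) ^ k + C' * (1 + ‖x‖) ^ k' := add_le_add (h x) (h' x)
    _ ≤ C * (1 + ‖x‖) ^ (k + k') + C' * (1 + ‖x‖) ^ (k + k') := by gcongr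
    _ = _ := by ring

theorem sub {f g : E → F} (hf : HasPolyGrowth f) (hg : HasPolyGrowth g) :
    HasPolyGrowth (fun x => f x - g x) := by
  simpa only [sub_eq_add_neg] using hf.add (of_norm_le hg (f := fun x => -g x) fun x => by simp)

theorem mul {f g : E → ℝ} (hf : HasPolyGrowth f) (hg : HasPolyGrowth g) :
    HasPolyGrowth (fun x => f x * g x) := by
  obtain ⟨C, k, hC, h⟩ := hf.exists_nonneg
  obtain ⟨C', k', hC', h'⟩ := hg.exists_nonneg
  refine ⟨C * C', k + k', fun x => ?_⟩
  calc ‖f x * g x‖ = ‖f x‖ * ‖g x‖ := norm_mul _ _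
    _ ≤ (C * (1 + ‖x‖) ^ k) * (C' * (1 + ‖x‖) ^ k') := by
      gcongr
      exacts [h x, h' x]
    _ = _ := by ring

theorem pow {f : E → ℝ} (hf : HasPolyGrowth f) (n : ℕ) : HasPolyGrowth (fun x => f x ^ n) := by
  induction n with
  | zero => simpa using const (1 : ℝ)
  | succ n ih => simpa only [pow_succ] using ih.mul hf

theorem inner [InnerProductSpace ℝ F] {f g : E → F} (hf : HasPolyGrowth f) (hg : HasPolyGrowth g) :
    HasPolyGrowth (fun x => ⟪f x, g x⟫_ℝ) :=
  of_norm_le (hf.norm.mul hg.norm) fun x => by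
    simpa using abs_real_inner_le_norm (f x) (g x)

theorem comp {g : F → G} {f : E → F} (hg : HasPolyGrowth g) (hf : HasPolyGrowth f) :
    HasPolyGrowth (fun x => g (f x)) := by
  obtain ⟨C, k, hC, h⟩ := hg.exists_nonneg
  exact of_norm_le ((const C).mul (((const 1).add hf.norm).pow k)) fun x =>
    (h _).trans (le_abs_self _)

end HasPolyGrowth

theorem HasPolyGrowth.integrable {E F : Type*} [NormedAddCommGroup E] [MeasurableSpace E]
    [BorelSpace E] [NormedAddCommGroup F] [SecondCountableTopologyEither E F] {μ : Measure E}
    (hμ : ∀ k : ℕ, Integrable (fun x => (1 + ‖x‖) ^ k) μ) {f : E → F} (hf : HasPolyGrowth f)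
    (hc : Continuous f) : Integrable f μ := by
  obtain ⟨C, k, h⟩ := hf
  exact ((hμ k).const_mul C).mono' hc.aestronglyMeasurable (ae_of_all _ h)

theorem integrable_one_add_norm_pow_prod {E : Type*} [NormedAddCommGroup E] [MeasurableSpace E]
    [BorelSpace E] [SecondCountableTopology E]
    {μ : Measure E} [SFinite μ] (hμ : ∀ k : ℕ, Integrable (fun x => (1 + ‖x‖) ^ k) μ) (k : ℕ) :
    Integrable (fun p : E × E => (1 + ‖p‖) ^ k) (μ.prod μ) := by
  refine ((hμ k).mul_prod (hμ k)).mono' (by fun_prop) (ae_of_all _ fun p => ?_)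
  rw [Real.norm_of_nonneg (by positivity), ← mul_pow]
  gcongr
  rw [Prod.norm_def]
  rcases max_cases ‖p.1‖ ‖p.2‖ with ⟨h, -⟩ | ⟨h, -⟩ <;> rw [h] <;>
    nlinarith [norm_nonneg p.1, norm_nonneg p.2, mul_nonneg (norm_nonneg p.1) (norm_nonneg p.2)]

section Gibbs

variable {E : Type*} [NormedAddCommGroup E] [InnerProductSpace ℝ E] [FiniteDimensional ℝ E]

theorem continuous_gradient {Φ : E → ℝ} (hΦ : ContDiff ℝ 1 Φ) : Continuous (gradient Φ) :=
  (InnerProductSpace.toDual ℝ E).symm.continuous.comp (hΦ.continuous_fderiv one_ne_zero)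

theorem exists_quadratic_lower_bound_of_dissipative {Φ : E → ℝ} (hΦ : ContDiff ℝ 1 Φ) {m b : ℝ}
    (hm : 0 < m) (hb : 0 ≤ b)
    (hdiss : ∀ x y, ⟪x - y, gradient Φ x - gradient Φ y⟫_ℝ ≥ m * ‖x - y‖ ^ 2 - b) :
    ∃ C, ∀ x, m / 4 * ‖x‖ ^ 2 - C ≤ Φ x := by
  obtain ⟨C₀, hC₀⟩ : ∃ C₀, ∀ x : E, ‖x‖ ≤ 1 → -C₀ ≤ Φ x := by
    obtain ⟨C, hC⟩ := (isCompact_closedBall (0 : E) 1).exists_bound_of_continuousOn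
      hΦ.continuous.continuousOn
    exact ⟨C, fun x hx => neg_le_of_abs_le (hC x (by simpa using hx))⟩
  set c := b + ‖gradient Φ 0‖ with hc
  have hc0 : 0 ≤ c := by positivity
  refine ⟨c ^ 2 / m + C₀ + m / 2, fun x => ?_⟩
  have hcm : 0 ≤ c ^ 2 / m := by positivity
  rcases le_or_gt ‖x‖ 1 with hx | hx
  · have := hC₀ x hx
    have : ‖x‖ ^ 2 ≤ 1 := pow_le_one₀ (norm_nonneg x) hx
    nlinarith
  set r := ‖x‖ with hr
  have hr0 : 0 < r := by linarith
  have hgrad : ∀ t : ℝ, HasDerivAt (fun t : ℝ => Φ (t • x)) ⟪gradient Φ (t • x), x⟫_ℝ t := by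
    intro t
    have h1 : HasFDerivAt Φ _ (t • x) :=
      ((hΦ.differentiable one_ne_zero) (t • x)).hasGradientAt.hasFDerivAt
    exact (h1.comp_hasDerivAt t ((hasDerivAt_id t).smul_const x)).congr_deriv (by simp)
  have hmono : MonotoneOn (fun t : ℝ => Φ (t • x) - m * r ^ 2 / 2 * t ^ 2 + c * r * t)
      (Set.Icc (1 / r) 1) := by
    have hd : ∀ t : ℝ, HasDerivAt (fun t : ℝ => Φ (t • x) - m * r ^ 2 / 2 * t ^ 2 + c * r * t)
        (⟪gradient Φ (t • x), x⟫_ℝ - m * r ^ 2 * t + c * r) t := fun t => by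
      refine (((hgrad t).sub ((hasDerivAt_pow 2 t).const_mul (m * r ^ 2 / 2))).add
        ((hasDerivAt_id t).const_mul (c * r))).congr_deriv ?_
      norm_num
      ring
    refine monotoneOn_of_hasDerivWithinAt_nonneg (convex_Icc _ _)
      (fun t _ => (hd t).continuousAt.continuousWithinAt) (fun t _ => (hd t).hasDerivWithinAt) ?_
    intro t ht
    rw [interior_Icc] at ht
    have ht1 : 1 < t * r := by rw [← div_lt_iff₀ hr0]; exact ht.1
    have ht0 : 0 < t := by
      by_contra h
      nlinarith
    have h := hdiss (t • x) 0
    rw [sub_zero, norm_smul, Real.norm_of_nonneg ht0.le, real_inner_smul_left, inner_sub_right,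
      ← hr] at h
    have h2 := neg_le_of_abs_le (abs_real_inner_le_norm x (gradient Φ 0))
    rw [real_inner_comm]
    have h3 : 0 ≤ t * (⟪x, gradient Φ (t • x)⟫_ℝ - m * r ^ 2 * t + c * r) := by
      rw [hc]
      have : t * (-(r * ‖gradient Φ 0‖)) ≤ t * ⟪x, gradient Φ 0⟫_ℝ := by gcongr
      nlinarith
    exact nonneg_of_mul_nonneg_right h3 ht0
  have hr1 : 1 / r ≤ 1 := by rw [div_le_one hr0]; exact hx.le
  have key := hmono (Set.left_mem_Icc.2 hr1) (Set.right_mem_Icc.2 hr1) hr1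
  have hb1 := hC₀ ((1 / r) • x) (by
    rw [norm_smul, Real.norm_of_nonneg (by positivity), ← hr, one_div, inv_mul_cancel₀ hr0.ne'])
  simp only [one_smul] at key
  have e1 : m * r ^ 2 / 2 * (1 / r) ^ 2 = m / 2 := by field_simp
  have e2 : c * r * (1 / r) = c := by field_simp
  rw [e1, e2] at key
  have e3 : c * r ≤ m / 4 * r ^ 2 + c ^ 2 / m := by
    have : m / 4 * r ^ 2 + c ^ 2 / m - c * r = (m * r / 2 - c) ^ 2 / m := by field_simp; ring
    have : 0 ≤ (m * r / 2 - c) ^ 2 / m := by positivity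
    linarith
  linarith

theorem integrable_exp_neg_mul_sq_norm [MeasurableSpace E] [BorelSpace E] {a : ℝ} (ha : 0 < a) :
    Integrable (fun x : E => Real.exp (-a * ‖x‖ ^ 2)) := by
  have h := (GaussianFourier.integrable_cexp_neg_mul_sq_norm_add (V := E) (b := (a : ℂ))
    (by simpa) 0 0).norm
  refine h.congr (ae_of_all _ fun x => ?_)
  simp only [Complex.norm_exp]
  congr 1
  norm_cast
  simp

theorem integrable_one_add_norm_pow_mul_exp_neg [MeasurableSpace E] [BorelSpace E] {Φ : E → ℝ}
    (hΦ : Continuous Φ) {a C : ℝ} (ha : 0 < a) (h : ∀ x, a * ‖x‖ ^ 2 - C ≤ Φ x) (k : ℕ) :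
    Integrable (fun x => Real.exp (-Φ x) * (1 + ‖x‖) ^ k) := by
  refine ((integrable_exp_neg_mul_sq_norm (E := E) (half_pos ha)).const_mul
    (k.factorial * Real.exp (C + 1 + 1 / (2 * a)))).mono' (by fun_prop) (ae_of_all _ fun x => ?_)
  rw [Real.norm_of_nonneg (by positivity)]
  have h1 : (1 + ‖x‖) ^ k ≤ k.factorial * Real.exp (1 + ‖x‖) := by
    have := Real.pow_div_factorial_le_exp (1 + ‖x‖) (by positivity) k
    rwa [div_le_iff₀' (by positivity)] at this
  have h2 : ‖x‖ ≤ a / 2 * ‖x‖ ^ 2 + 1 / (2 * a) := by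
    have : a / 2 * ‖x‖ ^ 2 + 1 / (2 * a) - ‖x‖ = (a * ‖x‖ - 1) ^ 2 / (2 * a) := by
      field_simp; ring
    have : 0 ≤ (a * ‖x‖ - 1) ^ 2 / (2 * a) := by positivity
    linarith
  calc Real.exp (-Φ x) * (1 + ‖x‖) ^ k
      ≤ Real.exp (-Φ x) * (k.factorial * Real.exp (1 + ‖x‖)) := by gcongr
    _ = k.factorial * Real.exp (-Φ x + (1 + ‖x‖)) := by rw [Real.exp_add (-Φ x)]; ring
    _ ≤ k.factorial * Real.exp ((C + 1 + 1 / (2 * a)) + -(a / 2) * ‖x‖ ^ 2) := by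
      refine mul_le_mul_of_nonneg_left (Real.exp_le_exp.2 ?_) (by positivity)
      linarith [h x]
    _ = _ := by rw [Real.exp_add]; ring

end Gibbs

section Stein

variable {E : Type*} [NormedAddCommGroup E] [InnerProductSpace ℝ E] [FiniteDimensional ℝ E]
  [MeasurableSpace E] [BorelSpace E]

/-- Integration by parts of a Gibbs density against the radial field
`x ↦ (α + β ‖x - y‖²) (x - y)`. -/
theorem integral_exp_neg_mul_radial_inner_gradient {Φ : E → ℝ} (hΦ : ContDiff ℝ 1 Φ)
    (hint : ∀ k : ℕ, Integrable (fun x => Real.exp (-Φ x) * (1 + ‖x‖) ^ k))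
    (hgrad : HasPolyGrowth (gradient Φ)) (α β : ℝ) (y : E) :
    ∫ x, Real.exp (-Φ x) * ((α + β * ‖x - y‖ ^ 2) * ⟪x - y, gradient Φ x⟫_ℝ) =
      ∫ x, Real.exp (-Φ x) * (Module.finrank ℝ E * α +
        (Module.finrank ℝ E + 2) * β * ‖x - y‖ ^ 2) := by
  have hgc := continuous_gradient hΦ
  have hΦc := hΦ.continuous
  have hI : ∀ f : E → ℝ, HasPolyGrowth f → Continuous f →
      Integrable (fun x => Real.exp (-Φ x) * f x) := by
    rintro f ⟨C, k, h⟩ hf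
    refine ((hint k).const_mul C).mono' (by fun_prop) (ae_of_all _ fun x => ?_)
    rw [norm_mul, Real.norm_of_nonneg (Real.exp_pos _).le]
    calc Real.exp (-Φ x) * ‖f x‖ ≤ Real.exp (-Φ x) * (C * (1 + ‖x‖) ^ k) := by gcongr; exact h x
      _ = _ := by ring
  let e := stdOrthonormalBasis ℝ E
  have hz : HasPolyGrowth (fun x : E => x - y) := .sub .id (.const y)
  have hq : HasPolyGrowth (fun x : E => α + β * ‖x - y‖ ^ 2) :=
    (HasPolyGrowth.const α).add (.mul (.const β) (hz.norm.pow 2))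
  have hzi : ∀ i, HasPolyGrowth (fun x : E => ⟪x - y, e i⟫_ℝ) := fun i => .inner hz (.const _)
  have hgi : ∀ i, HasPolyGrowth (fun x : E => ⟪gradient Φ x, e i⟫_ℝ) :=
    fun i => .inner hgrad (.const _)
  have hf : ∀ i x, HasFDerivAt (fun x : E => (α + β * ‖x - y‖ ^ 2) * ⟪x - y, e i⟫_ℝ)
      ((α + β * ‖x - y‖ ^ 2) • innerSL ℝ (e i) +
        ⟪x - y, e i⟫_ℝ • (β • (2 • innerSL ℝ (x - y)))) x := by
    intro i x
    have h1 : HasFDerivAt (fun x : E => x - y) (ContinuousLinearMap.id ℝ E) x :=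
      (hasFDerivAt_id x).sub_const y
    have h2 : HasFDerivAt (fun x : E => α + β * ‖x - y‖ ^ 2) (β • (2 • innerSL ℝ (x - y))) x := by
      simpa using (h1.norm_sq.const_mul β).const_add α
    have h3 : HasFDerivAt (fun x : E => ⟪x - y, e i⟫_ℝ) (innerSL ℝ (e i)) x := by
      simp_rw [real_inner_comm (e i)]
      exact ((innerSL ℝ (e i)).hasFDerivAt.comp x h1)
    exact h2.mul h3
  have hg : ∀ x, HasFDerivAt (fun x => Real.exp (-Φ x))
      (Real.exp (-Φ x) • -(InnerProductSpace.toDual ℝ E (gradient Φ x))) x := fun x =>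
    ((hΦ.differentiable one_ne_zero) x).hasGradientAt.hasFDerivAt.neg.exp
  have hf' : ∀ i x, fderiv ℝ (fun x : E => (α + β * ‖x - y‖ ^ 2) * ⟪x - y, e i⟫_ℝ) x (e i) =
      (α + β * ‖x - y‖ ^ 2) + 2 * β * ⟪x - y, e i⟫_ℝ ^ 2 := by
    intro i x
    rw [(hf i x).fderiv]
    simp [e.norm_eq_one, inner_sub_left]
    ring
  have hg' : ∀ i x, fderiv ℝ (fun x => Real.exp (-Φ x)) x (e i) =
      -(Real.exp (-Φ x) * ⟪gradient Φ x, e i⟫_ℝ) := by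
    intro i x
    rw [(hg x).fderiv]
    simp
  have hI1 : ∀ i, Integrable fun x => Real.exp (-Φ x) *
      ((α + β * ‖x - y‖ ^ 2) * ⟪x - y, e i⟫_ℝ * ⟪gradient Φ x, e i⟫_ℝ) := fun i =>
    hI _ ((hq.mul (hzi i)).mul (hgi i)) (by fun_prop)
  have hI2 : ∀ i, Integrable fun x => Real.exp (-Φ x) *
      ((α + β * ‖x - y‖ ^ 2) + 2 * β * ⟪x - y, e i⟫_ℝ ^ 2) := fun i =>
    hI _ (hq.add ((HasPolyGrowth.const (2 * β)).mul ((hzi i).pow 2))) (by fun_prop)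
  have hI3 : ∀ i, Integrable fun x => Real.exp (-Φ x) *
      ((α + β * ‖x - y‖ ^ 2) * ⟪x - y, e i⟫_ℝ) := fun i =>
    hI _ (hq.mul (hzi i)) (by fun_prop)
  have hparts : ∀ i, ∫ x, Real.exp (-Φ x) *
      ((α + β * ‖x - y‖ ^ 2) * ⟪x - y, e i⟫_ℝ * ⟪gradient Φ x, e i⟫_ℝ) =
      ∫ x, Real.exp (-Φ x) * ((α + β * ‖x - y‖ ^ 2) + 2 * β * ⟪x - y, e i⟫_ℝ ^ 2) := by
    intro i
    have h := integral_mul_fderiv_eq_neg_fderiv_mul_of_integrable (μ := (volume : Measure E))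
      (f := fun x : E => (α + β * ‖x - y‖ ^ 2) * ⟪x - y, e i⟫_ℝ)
      (g := fun x => Real.exp (-Φ x)) (v := e i)
      ((hI2 i).congr (ae_of_all _ fun x => by simp only [hf']; ring))
      ((hI1 i).neg.congr (ae_of_all _ fun x => by simp only [hg', Pi.neg_apply]; ring))
      ((hI3 i).congr (ae_of_all _ fun x => by ring))
      (fun x _ => (hf i x).differentiableAt) (fun x _ => (hg x).differentiableAt)
    simp only [hf', hg', mul_neg, integral_neg, neg_inj] at h
    calc _ = _ := integral_congr_ae (ae_of_all _ fun x => by ring)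
      _ = _ := h
      _ = _ := integral_congr_ae (ae_of_all _ fun x => by ring)
  calc _ = ∫ x, ∑ i, Real.exp (-Φ x) *
        ((α + β * ‖x - y‖ ^ 2) * ⟪x - y, e i⟫_ℝ * ⟪gradient Φ x, e i⟫_ℝ) := by
        congr 1 with x
        rw [← e.sum_inner_mul_inner, ← Finset.mul_sum, Finset.mul_sum]
        congr 1
        refine Finset.sum_congr rfl fun i _ => ?_
        rw [real_inner_comm (gradient Φ x)]
        ring
    _ = ∑ i, ∫ x, Real.exp (-Φ x) * ((α + β * ‖x - y‖ ^ 2) + 2 * β * ⟪x - y, e i⟫_ℝ ^ 2) := by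
        rw [integral_finsetSum _ fun i _ => hI1 i]
        exact Finset.sum_congr rfl fun i _ => hparts i
    _ = _ := by
        rw [← integral_finsetSum _ fun i _ => hI2 i]
        congr 1 with x
        have hs := e.sum_sq_inner_left (x - y)
        rw [← Finset.mul_sum, Finset.sum_add_distrib, ← Finset.mul_sum, hs]
        simp
        ring

end Stein

section TwoPoint

variable {E : Type*} [NormedAddCommGroup E] [InnerProductSpace ℝ E] [FiniteDimensional ℝ E]
  [MeasurableSpace E] [BorelSpace E]

/-- A radial Stein identity and two-point dissipativity bound the weighted moments of the
difference of two independent copies. -/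
theorem integral_prod_radial_le {μ : Measure E} [IsProbabilityMeasure μ]
    (hμ : ∀ k : ℕ, Integrable (fun x => (1 + ‖x‖) ^ k) μ) {g : E → E} (hgc : Continuous g)
    (hg : HasPolyGrowth g) {m b n α β : ℝ} (hα : 0 ≤ α) (hβ : 0 ≤ β)
    (hdiss : ∀ x y, ⟪x - y, g x - g y⟫_ℝ ≥ m * ‖x - y‖ ^ 2 - b)
    (hstein : ∀ y, ∫ x, (α + β * ‖x - y‖ ^ 2) * ⟪x - y, g x⟫_ℝ ∂μ =
      ∫ x, (n * α + (n + 2) * β * ‖x - y‖ ^ 2) ∂μ) :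
    m * ∫ p, (α * ‖p.1 - p.2‖ ^ 2 + β * ‖p.1 - p.2‖ ^ 4) ∂μ.prod μ ≤
      ∫ p, ((2 * n + b) * α + (2 * n + 4 + b) * β * ‖p.1 - p.2‖ ^ 2) ∂μ.prod μ := by
  have hI : ∀ f : E × E → ℝ, HasPolyGrowth f → Continuous f → Integrable f (μ.prod μ) :=
    fun f hf hc => hf.integrable (integrable_one_add_norm_pow_prod hμ) hc
  have hz : HasPolyGrowth (fun p : E × E => p.1 - p.2) := .sub .fst .snd
  have hq : HasPolyGrowth (fun p : E × E => α + β * ‖p.1 - p.2‖ ^ 2) :=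
    (HasPolyGrowth.const α).add (.mul (.const β) (hz.norm.pow 2))
  have h1 := hI (fun p => (α + β * ‖p.1 - p.2‖ ^ 2) * ⟪p.1 - p.2, g p.1⟫_ℝ)
    (hq.mul (hz.inner (hg.comp .fst))) (by fun_prop)
  have h2 := hI (fun p => (α + β * ‖p.1 - p.2‖ ^ 2) * ⟪p.1 - p.2, g p.2⟫_ℝ)
    (hq.mul (hz.inner (hg.comp .snd))) (by fun_prop)
  have h3 := hI (fun p => n * α + (n + 2) * β * ‖p.1 - p.2‖ ^ 2)
    ((HasPolyGrowth.const _).add (.mul (.const _) (hz.norm.pow 2))) (by fun_prop)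
  have h4 := hI (fun p => α * ‖p.1 - p.2‖ ^ 2 + β * ‖p.1 - p.2‖ ^ 4)
    (((HasPolyGrowth.const _).mul (hz.norm.pow 2)).add (.mul (.const _) (hz.norm.pow 4)))
    (by fun_prop)
  have h5 := hI (fun p => α + β * ‖p.1 - p.2‖ ^ 2) hq (by fun_prop)
  have e1 : ∫ p, (α + β * ‖p.1 - p.2‖ ^ 2) * ⟪p.1 - p.2, g p.1⟫_ℝ ∂μ.prod μ =
      ∫ p, (n * α + (n + 2) * β * ‖p.1 - p.2‖ ^ 2) ∂μ.prod μ := by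
    rw [integral_prod_symm _ h1, integral_prod_symm _ h3]
    exact integral_congr_ae (ae_of_all _ hstein)
  have e2 : ∫ p, (α + β * ‖p.1 - p.2‖ ^ 2) * ⟪p.1 - p.2, g p.2⟫_ℝ ∂μ.prod μ =
      -∫ p, (n * α + (n + 2) * β * ‖p.1 - p.2‖ ^ 2) ∂μ.prod μ := by
    rw [← e1, ← integral_neg, ← integral_prod_swap]
    congr 1 with p
    rw [Prod.fst_swap, Prod.snd_swap, norm_sub_rev, ← neg_sub, inner_neg_left]
    ring
  have hle : m * ∫ p, (α * ‖p.1 - p.2‖ ^ 2 + β * ‖p.1 - p.2‖ ^ 4) ∂μ.prod μ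
      - b * ∫ p, (α + β * ‖p.1 - p.2‖ ^ 2) ∂μ.prod μ ≤
      ∫ p, (α + β * ‖p.1 - p.2‖ ^ 2) * ⟪p.1 - p.2, g p.1⟫_ℝ ∂μ.prod μ -
      ∫ p, (α + β * ‖p.1 - p.2‖ ^ 2) * ⟪p.1 - p.2, g p.2⟫_ℝ ∂μ.prod μ := by
    rw [← integral_const_mul, ← integral_const_mul,
      ← integral_sub (h4.const_mul m) (h5.const_mul b), ← integral_sub h1 h2]
    refine integral_mono ((h4.const_mul m).sub (h5.const_mul b)) (h1.sub h2) fun p => ?_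
    have := mul_le_mul_of_nonneg_left (hdiss p.1 p.2)
      (show 0 ≤ α + β * ‖p.1 - p.2‖ ^ 2 by positivity)
    rw [inner_sub_right] at this
    dsimp only
    linarith
  have e3 : ∫ p, ((2 * n + b) * α + (2 * n + 4 + b) * β * ‖p.1 - p.2‖ ^ 2) ∂μ.prod μ =
      2 * ∫ p, (n * α + (n + 2) * β * ‖p.1 - p.2‖ ^ 2) ∂μ.prod μ +
      b * ∫ p, (α + β * ‖p.1 - p.2‖ ^ 2) ∂μ.prod μ := by
    rw [← integral_const_mul, ← integral_const_mul,
      ← integral_add (h3.const_mul 2) (h5.const_mul b)]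
    congr 1 with p
    ring
  rw [e1, e2] at hle
  linarith

theorem integral_prod_norm_sub_sq {μ : Measure E} [IsProbabilityMeasure μ]
    (hμ : ∀ k : ℕ, Integrable (fun x => (1 + ‖x‖) ^ k) μ) :
    ∫ p, ‖p.1 - p.2‖ ^ 2 ∂μ.prod μ = 2 * ∫ x, ‖x - ∫ y, y ∂μ‖ ^ 2 ∂μ := by
  set c := ∫ y, y ∂μ with hc
  have hid : Integrable (fun x : E => x) μ := HasPolyGrowth.id.integrable hμ continuous_id
  have hsub : Integrable (fun x : E => x - c) μ := hid.sub (integrable_const c)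
  have hsq : Integrable (fun x => ‖x - c‖ ^ 2) μ :=
    ((HasPolyGrowth.id.sub (.const c)).norm.pow 2).integrable hμ (by fun_prop)
  have hp : Integrable (fun p : E × E => ‖p.1 - p.2‖ ^ 2) (μ.prod μ) :=
    ((HasPolyGrowth.fst.sub .snd).norm.pow 2).integrable (integrable_one_add_norm_pow_prod hμ)
      (by fun_prop)
  have h0 : ∫ x, (x - c) ∂μ = 0 := by
    rw [integral_sub hid (integrable_const c)]
    simp [hc]
  rw [integral_prod _ hp]
  have inner_eq : ∀ x, ∫ y, ‖x - y‖ ^ 2 ∂μ = ‖x - c‖ ^ 2 + ∫ y, ‖y - c‖ ^ 2 ∂μ := by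
    intro x
    have hcross : Integrable (fun y => 2 * ⟪x - c, y - c⟫_ℝ) μ := (hsub.const_inner _).const_mul 2
    have : ∀ y, ‖x - y‖ ^ 2 = ‖x - c‖ ^ 2 - 2 * ⟪x - c, y - c⟫_ℝ + ‖y - c‖ ^ 2 := fun y => by
      rw [← norm_sub_sq_real, sub_sub_sub_cancel_right]
    have hdiff : Integrable (fun y => ‖x - c‖ ^ 2 - 2 * ⟪x - c, y - c⟫_ℝ) μ :=
      (integrable_const _).sub hcross
    rw [integral_congr_ae (ae_of_all _ this), integral_add hdiff hsq,
      integral_sub (integrable_const _) hcross, integral_const_mul, integral_inner hsub, h0]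
    simp
  simp_rw [inner_eq]
  rw [integral_add hsq (integrable_const _)]
  simp
  ring

theorem integral_norm_sub_integral_pow_le {μ : Measure E} [IsProbabilityMeasure μ]
    (hμ : ∀ k : ℕ, Integrable (fun x => (1 + ‖x‖) ^ k) μ) (k : ℕ) :
    ∫ x, ‖x - ∫ y, y ∂μ‖ ^ k ∂μ ≤ ∫ p, ‖p.1 - p.2‖ ^ k ∂μ.prod μ := by
  have hid : Integrable (fun x : E => x) μ := HasPolyGrowth.id.integrable hμ continuous_id
  have hp : Integrable (fun p : E × E => ‖p.1 - p.2‖ ^ k) (μ.prod μ) :=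
    ((HasPolyGrowth.fst.sub .snd).norm.pow k).integrable (integrable_one_add_norm_pow_prod hμ)
      (by fun_prop)
  rw [integral_prod _ hp]
  refine integral_mono (((HasPolyGrowth.id.sub (.const _)).norm.pow k).integrable hμ
    (by fun_prop)) hp.integral_prod_left fun x => ?_
  have hconv : ConvexOn ℝ Set.univ (fun z : E => ‖z‖ ^ k) :=
    convexOn_univ_norm.pow (fun _ _ => norm_nonneg _) k
  have hx : ∫ y, (x - y) ∂μ = x - ∫ y, y ∂μ := by
    rw [integral_sub (integrable_const x) hid]
    simp
  have := hconv.map_integral_le (f := fun y => x - y) (μ := μ) (by fun_prop) isClosed_univ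
    (by simp) ((integrable_const x).sub hid)
    ((((HasPolyGrowth.const x).sub .id).norm.pow k).integrable hμ (by fun_prop))
  rwa [hx] at this

end TwoPoint

theorem stmt_11 {d : ℕ} (Φ : EuclideanSpace ℝ (Fin d) → ℝ) (hΦ : ContDiff ℝ 1 Φ)
    (m b G L : ℝ) (hm : 0 < m) (hb : 0 ≤ b)
    (hdiss : ∀ x y : EuclideanSpace ℝ (Fin d),
      ⟪x - y, gradient Φ x - gradient Φ y⟫_ℝ ≥ m * ‖x - y‖ ^ 2 - b)
    (hgrow : ∀ x : EuclideanSpace ℝ (Fin d), ‖gradient Φ x‖ ≤ G + L * ‖x‖)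
    (μ : Measure (EuclideanSpace ℝ (Fin d)))
    (hμ : μ = volume.withDensity fun x =>
      ENNReal.ofReal (Real.exp (-Φ x) / ∫ y : EuclideanSpace ℝ (Fin d), Real.exp (-Φ y))) :
    (∫ x, ‖x - (∫ y, y ∂μ : EuclideanSpace ℝ (Fin d))‖ ^ 2 ∂μ) ≤ (2 * (d : ℝ) + b) / (2 * m) ∧
    (∫ x, ‖x - (∫ y, y ∂μ : EuclideanSpace ℝ (Fin d))‖ ^ 4 ∂μ) ≤
      (2 * (d : ℝ) + 4 + b) * (2 * (d : ℝ) + b) / m ^ 2 := by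
  obtain ⟨C, hC⟩ := exists_quadratic_lower_bound_of_dissipative hΦ hm hb hdiss
  have hint := integrable_one_add_norm_pow_mul_exp_neg hΦ.continuous (by positivity) hC
  have hexp : Integrable (fun x => Real.exp (-Φ x)) := by simpa using hint 0
  have hgrad : HasPolyGrowth (gradient Φ) :=
    ((HasPolyGrowth.const G).add (.mul (.const L) HasPolyGrowth.id.norm)).of_norm_le
      fun x => (hgrow x).trans (le_abs_self _)
  have htilt : μ = volume.tilted (fun x => -Φ x) := hμ
  have hprob : IsProbabilityMeasure μ := htilt ▸ isProbabilityMeasure_tilted hexp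
  have hmom : ∀ k : ℕ, Integrable (fun x => (1 + ‖x‖) ^ k) μ := fun k => by
    rw [htilt, integrable_tilted_iff hexp]
    exact hint k
  have hstein : ∀ α β y, ∫ x, (α + β * ‖x - y‖ ^ 2) * ⟪x - y, gradient Φ x⟫_ℝ ∂μ =
      ∫ x, (d * α + (d + 2) * β * ‖x - y‖ ^ 2) ∂μ := by
    intro α β y
    have h := integral_exp_neg_mul_radial_inner_gradient hΦ hint hgrad α β y
    rw [finrank_euclideanSpace_fin] at h
    rw [htilt, integral_tilted, integral_tilted]
    simp_rw [smul_eq_mul, div_mul_eq_mul_div, integral_div]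
    rw [h]
  have hgc := continuous_gradient hΦ
  have h2 := integral_prod_radial_le hmom hgc hgrad zero_le_one le_rfl hdiss (hstein 1 0)
  have h4 := integral_prod_radial_le hmom hgc hgrad le_rfl zero_le_one hdiss (hstein 0 1)
  simp only [one_mul, zero_mul, mul_one, mul_zero, add_zero, zero_add, integral_const,
    probReal_univ, smul_eq_mul, integral_const_mul] at h2 h4
  have hJ := integral_norm_sub_integral_pow_le hmom 4
  have hd : (0 : ℝ) ≤ d := d.cast_nonneg
  constructor
  · rw [integral_prod_norm_sub_sq hmom] at h2
    rw [le_div_iff₀ (by positivity)]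
    linarith
  · refine hJ.trans ?_
    rw [le_div_iff₀ (by positivity)]
    have := mul_le_mul_of_nonneg_left h4 hm.le
    have := mul_le_mul_of_nonneg_left h2 (show 0 ≤ 2 * (d : ℝ) + 4 + b by positivity)
    linarith
end

section
/- Let V : ℝ^d → ℝ be continuously differentiable with ‖∇V(x)‖ ≤ G + L‖x‖ and ⟨x, ∇V(x)⟩ ≥ c‖x‖² - C for all x (c > 0, C ≥ 0), and fix a > 0 and γ > 0. Define q(y) := ∫_{ℝ^d} exp(-V(x) - ‖y - a x‖²/(2γ²)) dx. Then q is finite, strictly positive, and differentiable on ℝ^d, and its gradient satisfies ∇q(y) = -(1/a) ∫_{ℝ^d} ∇V(x) · exp(-V(x) - ‖y - a x‖²/(2γ²)) dx for every y. -/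
open MeasureTheory
open scoped InnerProductSpace

section InnerProductSpace

variable {E : Type*} [NormedAddCommGroup E] [InnerProductSpace ℝ E] [FiniteDimensional ℝ E]

/-- A radially dissipative `C¹` function is bounded below. -/
lemma exists_forall_le_of_radially_dissipative {V : E → ℝ} (hV : ContDiff ℝ 1 V) {c C : ℝ}
    (hc : 0 < c) (hC : 0 ≤ C) (hdiss : ∀ x, ⟪x, gradient V x⟫_ℝ ≥ c * ‖x‖ ^ 2 - C) :
    ∃ m, ∀ x, m ≤ V x := by
  set R : ℝ := C / c + 1 with hR
  have hCc : 0 ≤ C / c := by positivity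
  have hRpos : 0 < R := by positivity
  have hcR : C ≤ c * R ^ 2 := by
    have h1 : c * (C / c) = C := by field_simp
    have h2 : C / c ≤ R ^ 2 := by nlinarith
    nlinarith [mul_le_mul_of_nonneg_left h2 hc.le]
  obtain ⟨m, hm⟩ := (isCompact_closedBall (0 : E) R).bddBelow_image hV.continuous.continuousOn
  have hball : ∀ x : E, ‖x‖ ≤ R → m ≤ V x := fun x hx =>
    hm ⟨x, by simpa using hx, rfl⟩
  refine ⟨m, fun x => ?_⟩
  rcases le_or_gt ‖x‖ R with hx | hx
  · exact hball x hx
  have hxpos : 0 < ‖x‖ := hRpos.trans hx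
  have hderiv : ∀ t : ℝ, HasDerivAt (fun t : ℝ => V (t • x)) ⟪gradient V (t • x), x⟫_ℝ t := by
    intro t
    have h1 : HasFDerivAt V (InnerProductSpace.toDual ℝ E (gradient V (t • x))) (t • x) :=
      ((hV.differentiable one_ne_zero) _).hasGradientAt.hasFDerivAt
    have h2 : HasDerivAt (fun t : ℝ => t • x) x t := by
      simpa using (hasDerivAt_id t).smul_const x
    exact h1.comp_hasDerivAt t h2
  have hmono : MonotoneOn (fun t : ℝ => V (t • x)) (Set.Icc (R / ‖x‖) 1) := by
    refine monotoneOn_of_deriv_nonneg (convex_Icc _ _)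
      (fun t _ => (hderiv t).continuousAt.continuousWithinAt)
      (fun t _ => (hderiv t).differentiableAt.differentiableWithinAt) fun t ht => ?_
    rw [interior_Icc] at ht
    have ht0 : 0 < t := (div_pos hRpos hxpos).trans ht.1
    have htR : R ≤ ‖t • x‖ := by
      rw [norm_smul, Real.norm_of_nonneg ht0.le]
      exact (div_le_iff₀ hxpos).1 ht.1.le
    have h := hdiss (t • x)
    rw [real_inner_smul_left, real_inner_comm] at h
    have hsq : R ^ 2 ≤ ‖t • x‖ ^ 2 := by gcongr
    rw [(hderiv t).deriv]
    have : 0 ≤ t * ⟪gradient V (t • x), x⟫_ℝ := by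
      nlinarith [mul_le_mul_of_nonneg_left hsq hc.le]
    exact nonneg_of_mul_nonneg_right this ht0
  have hle : R / ‖x‖ ≤ 1 := (div_le_one hxpos).2 hx.le
  have h := hmono (Set.left_mem_Icc.2 hle) (Set.right_mem_Icc.2 hle) hle
  simp only [one_smul] at h
  refine (hball _ ?_).trans h
  rw [norm_smul, Real.norm_of_nonneg (by positivity), div_mul_cancel₀ _ hxpos.ne']

variable [MeasurableSpace E] [BorelSpace E]

lemma integrable_exp_neg_mul_norm_sq {b : ℝ} (hb : 0 < b) :
    Integrable (fun x : E => Real.exp (-b * ‖x‖ ^ 2)) := by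
  have h := (GaussianFourier.integrable_cexp_neg_mul_sq_norm_add (V := E) (b := (b : ℂ))
    (by simpa using hb) 0 0).re
  refine h.congr (Filter.Eventually.of_forall fun x => ?_)
  have : (-(b : ℂ) * (‖x‖ : ℂ) ^ 2 + 0 * ((⟪(0 : E), x⟫_ℝ : ℝ) : ℂ))
      = ((-b * ‖x‖ ^ 2 : ℝ) : ℂ) := by push_cast; ring
  simp only [this]
  exact Complex.exp_ofReal_re _

lemma integrable_affine_norm_mul_exp_neg_mul_norm_sq (A B : ℝ) {b : ℝ} (hb : 0 < b) :
    Integrable (fun x : E => (A + B * ‖x‖) * Real.exp (-b * ‖x‖ ^ 2)) := by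
  have h1 : Integrable (fun x : E => ‖x‖ * Real.exp (-b * ‖x‖ ^ 2)) := by
    refine ((integrable_exp_neg_mul_norm_sq (E := E) (half_pos hb)).const_mul
      (1 + 1 / (2 * b))).mono' (by fun_prop) (Filter.Eventually.of_forall fun x => ?_)
    rw [Real.norm_of_nonneg (by positivity)]
    have hs : Real.exp (-b * ‖x‖ ^ 2)
        = Real.exp (-(b / 2) * ‖x‖ ^ 2) * Real.exp (-(b / 2) * ‖x‖ ^ 2) := by
      rw [← Real.exp_add]; ring_nf
    have he : ‖x‖ * Real.exp (-(b / 2) * ‖x‖ ^ 2) ≤ 1 + 1 / (2 * b) := by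
      rw [neg_mul, Real.exp_neg, ← div_eq_mul_inv, div_le_iff₀ (Real.exp_pos _)]
      have hexp := Real.add_one_le_exp (b / 2 * ‖x‖ ^ 2)
      have hK : (1 + 1 / (2 * b)) * (b / 2 * ‖x‖ ^ 2 + 1)
          = b / 2 * ‖x‖ ^ 2 + 1 + ‖x‖ ^ 2 / 4 + 1 / (2 * b) := by
        field_simp; ring
      have hm := mul_le_mul_of_nonneg_left hexp (by positivity : 0 ≤ 1 + 1 / (2 * b))
      have hp : 0 ≤ 1 / (2 * b) := by positivity
      have hp2 : 0 ≤ b / 2 * ‖x‖ ^ 2 := by positivity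
      nlinarith [sq_nonneg (1 - ‖x‖ / 2)]
    rw [hs, ← mul_assoc]
    gcongr
  refine (((integrable_exp_neg_mul_norm_sq (E := E) hb).const_mul A).add
    (h1.const_mul B)).congr (Filter.Eventually.of_forall fun x => ?_)
  simp only [Pi.add_apply]
  ring

end InnerProductSpace

lemma exp_neg_sub_gaussian_le {E : Type*} [NormedAddCommGroup E] [InnerProductSpace ℝ E]
    {V : E → ℝ} {m K a γ : ℝ} (hm : ∀ x, m ≤ V x) (hγ : 0 < γ) {y : E}
    (hy : ‖y‖ ≤ K) (x : E) :
    Real.exp (-V x - ‖y - a • x‖ ^ 2 / (2 * γ ^ 2)) ≤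
      Real.exp (-m + K ^ 2 / (2 * γ ^ 2)) * Real.exp (-(a ^ 2 / (4 * γ ^ 2)) * ‖x‖ ^ 2) := by
  rw [← Real.exp_add, Real.exp_le_exp]
  have h1 : ‖a • x‖ ≤ ‖y‖ + ‖y - a • x‖ := by
    simpa using norm_sub_le y (y - a • x)
  have h2 : ‖a • x‖ ^ 2 = a ^ 2 * ‖x‖ ^ 2 := by
    rw [norm_smul, mul_pow, Real.norm_eq_abs, sq_abs]
  have h3 : a ^ 2 * ‖x‖ ^ 2 / 2 - K ^ 2 ≤ ‖y - a • x‖ ^ 2 := by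
    have h4 : ‖a • x‖ ^ 2 ≤ (K + ‖y - a • x‖) ^ 2 := by gcongr; linarith
    nlinarith [sq_nonneg (K - ‖y - a • x‖)]
  have h5 := div_le_div_of_nonneg_right h3 (by positivity : 0 ≤ 2 * γ ^ 2)
  have h6 : (a ^ 2 * ‖x‖ ^ 2 / 2 - K ^ 2) / (2 * γ ^ 2)
      = a ^ 2 / (4 * γ ^ 2) * ‖x‖ ^ 2 - K ^ 2 / (2 * γ ^ 2) := by
    field_simp; ring
  linarith [hm x]

theorem stmt_13 {d : ℕ} (V : EuclideanSpace ℝ (Fin d) → ℝ) (hV : ContDiff ℝ 1 V)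
    (c C G L : ℝ) (hc : 0 < c) (hC : 0 ≤ C)
    (hgrow : ∀ x : EuclideanSpace ℝ (Fin d), ‖gradient V x‖ ≤ G + L * ‖x‖)
    (hdiss : ∀ x : EuclideanSpace ℝ (Fin d), ⟪x, gradient V x⟫_ℝ ≥ c * ‖x‖ ^ 2 - C)
    (a γ : ℝ) (ha : 0 < a) (hγ : 0 < γ)
    (q : EuclideanSpace ℝ (Fin d) → ℝ)
    (hq : ∀ y, q y = ∫ x, Real.exp (-V x - ‖y - a • x‖ ^ 2 / (2 * γ ^ 2))) :
    ∀ y : EuclideanSpace ℝ (Fin d),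
      Integrable (fun x : EuclideanSpace ℝ (Fin d) =>
        Real.exp (-V x - ‖y - a • x‖ ^ 2 / (2 * γ ^ 2))) ∧
      0 < q y ∧
      Integrable (fun x : EuclideanSpace ℝ (Fin d) =>
        Real.exp (-V x - ‖y - a • x‖ ^ 2 / (2 * γ ^ 2)) • gradient V x) ∧
      HasGradientAt q
        ((-(1 / a)) • ∫ x, Real.exp (-V x - ‖y - a • x‖ ^ 2 / (2 * γ ^ 2)) • gradient V x) y := by
  intro y
  obtain ⟨m, hm⟩ := exists_forall_le_of_radially_dissipative hV hc hC hdiss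
  have hVc : Continuous V := hV.continuous
  have hVd : Differentiable ℝ V := hV.differentiable one_ne_zero
  have hgc : Continuous (gradient V) :=
    (InnerProductSpace.toDual ℝ _).symm.continuous.comp (hV.continuous_fderiv one_ne_zero)
  have hb : 0 < a ^ 2 / (4 * γ ^ 2) := by positivity
  have hdom : ∀ A B : ℝ, Integrable fun x : EuclideanSpace ℝ (Fin d) =>
      Real.exp (-m + (‖y‖ + 1) ^ 2 / (2 * γ ^ 2)) *
        ((A + B * ‖x‖) * Real.exp (-(a ^ 2 / (4 * γ ^ 2)) * ‖x‖ ^ 2)) := fun A B =>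
    (integrable_affine_norm_mul_exp_neg_mul_norm_sq A B hb).const_mul _
  have hle : ∀ z : EuclideanSpace ℝ (Fin d), ‖z‖ ≤ ‖y‖ + 1 → ∀ (x) (s A B : ℝ), 0 ≤ s →
      s ≤ A + B * ‖x‖ → Real.exp (-V x - ‖z - a • x‖ ^ 2 / (2 * γ ^ 2)) * s ≤
      Real.exp (-m + (‖y‖ + 1) ^ 2 / (2 * γ ^ 2)) *
        ((A + B * ‖x‖) * Real.exp (-(a ^ 2 / (4 * γ ^ 2)) * ‖x‖ ^ 2)) := by
    intro z hz x s A B hs hsle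
    have h := mul_le_mul (exp_neg_sub_gaussian_le (a := a) hm hγ hz x) hsle hs (by positivity)
    linarith
  have hy1 : ‖y‖ ≤ ‖y‖ + 1 := by linarith
  have hint_smul : ∀ (w : EuclideanSpace ℝ (Fin d) → EuclideanSpace ℝ (Fin d)),
      Continuous w → (∃ A B : ℝ, ∀ x, ‖w x‖ ≤ A + B * ‖x‖) → Integrable fun x =>
        Real.exp (-V x - ‖y - a • x‖ ^ 2 / (2 * γ ^ 2)) • w x := by
    rintro w hw ⟨A, B, hAB⟩
    refine (hdom A B).mono' (by fun_prop) (Filter.Eventually.of_forall fun x => ?_)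
    rw [norm_smul, Real.norm_of_nonneg (Real.exp_pos _).le]
    exact hle y hy1 x _ A B (norm_nonneg _) (hAB x)
  have hint : Integrable (fun x : EuclideanSpace ℝ (Fin d) =>
      Real.exp (-V x - ‖y - a • x‖ ^ 2 / (2 * γ ^ 2))) := by
    refine (hdom 1 0).mono' (by fun_prop) (Filter.Eventually.of_forall fun x => ?_)
    rw [Real.norm_of_nonneg (Real.exp_pos _).le]
    simpa using hle y hy1 x 1 1 0 zero_le_one (by simp)
  have hintV := hint_smul (gradient V) hgc ⟨G, L, hgrow⟩
  have hnorm : ∀ z x : EuclideanSpace ℝ (Fin d), ‖z‖ ≤ ‖y‖ + 1 →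
      ‖(-(1 / γ ^ 2)) • (z - a • x)‖ ≤ 1 / γ ^ 2 * (‖y‖ + 1) + 1 / γ ^ 2 * a * ‖x‖ := by
    intro z x hz
    rw [norm_smul, norm_neg, Real.norm_of_nonneg (by positivity), mul_assoc, ← mul_add]
    gcongr
    refine (norm_sub_le _ _).trans (add_le_add hz ?_)
    rw [norm_smul, Real.norm_of_nonneg ha.le]
  have hintY := hint_smul (fun x => (-(1 / γ ^ 2)) • (y - a • x)) (by fun_prop)
    ⟨_, _, fun x => hnorm y x hy1⟩
  have hder : HasFDerivAt (fun z => ∫ x, Real.exp (-V x - ‖z - a • x‖ ^ 2 / (2 * γ ^ 2)))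
      (∫ x, InnerProductSpace.toDual ℝ (EuclideanSpace ℝ (Fin d))
        (Real.exp (-V x - ‖y - a • x‖ ^ 2 / (2 * γ ^ 2)) • (-(1 / γ ^ 2)) • (y - a • x))) y := by
    refine hasFDerivAt_integral_of_dominated_of_fderiv_le
      (F := fun z x => Real.exp (-V x - ‖z - a • x‖ ^ 2 / (2 * γ ^ 2)))
      (F' := fun z x => InnerProductSpace.toDual ℝ (EuclideanSpace ℝ (Fin d))
        (Real.exp (-V x - ‖z - a • x‖ ^ 2 / (2 * γ ^ 2)) • (-(1 / γ ^ 2)) • (z - a • x)))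
      (Metric.ball_mem_nhds y one_pos)
      (Filter.Eventually.of_forall fun z => by fun_prop) hint
      ?_ (Filter.Eventually.of_forall fun x z hz => ?_)
      (hdom (1 / γ ^ 2 * (‖y‖ + 1)) (1 / γ ^ 2 * a))
      (Filter.Eventually.of_forall fun x z _ => ?_)
    · exact ((InnerProductSpace.toDual ℝ (EuclideanSpace ℝ (Fin d))).continuous.comp
        (by fun_prop)).aestronglyMeasurable
    · have hz' : ‖z‖ ≤ ‖y‖ + 1 := by
        have := norm_le_norm_add_norm_sub' z y
        rw [mem_ball_iff_norm] at hz
        linarith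
      rw [LinearIsometryEquiv.norm_map, norm_smul, Real.norm_of_nonneg (Real.exp_pos _).le]
      exact hle z hz' x _ _ _ (norm_nonneg _) (hnorm z x hz')
    · have h := (((((hasFDerivAt_id z).sub_const (a • x)).norm_sq).mul_const
        (2 * γ ^ 2)⁻¹).const_sub (-V x)).exp
      simp only [← div_eq_mul_inv, id] at h
      refine h.congr_fderiv ?_
      ext v
      simp
      field_simp
  have hibp : ∀ v : EuclideanSpace ℝ (Fin d),
      ∫ x, Real.exp (-V x - ‖y - a • x‖ ^ 2 / (2 * γ ^ 2)) * ⟪(-(1 / γ ^ 2)) • (y - a • x), v⟫_ℝ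
      = -(1 / a) * ∫ x, Real.exp (-V x - ‖y - a • x‖ ^ 2 / (2 * γ ^ 2)) * ⟪gradient V x, v⟫_ℝ := by
    intro v
    have hf : ∀ x, HasFDerivAt (fun x => Real.exp (-V x))
        (Real.exp (-V x) • -(InnerProductSpace.toDual ℝ _ (gradient V x))) x := fun x =>
      (hVd x).hasGradientAt.hasFDerivAt.neg.exp
    have hg : ∀ x, HasFDerivAt (fun x => Real.exp (-(‖y - a • x‖ ^ 2 / (2 * γ ^ 2))))
        (Real.exp (-(‖y - a • x‖ ^ 2 / (2 * γ ^ 2))) •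
          ((-a) • InnerProductSpace.toDual ℝ _ ((-(1 / γ ^ 2)) • (y - a • x)))) x := by
      intro x
      have h := (((((hasFDerivAt_id x).const_smul a).const_sub y).norm_sq).mul_const
        (2 * γ ^ 2)⁻¹).neg.exp
      simp only [← div_eq_mul_inv] at h
      refine h.congr_fderiv ?_
      ext v
      simp
      field_simp
    have hsplit : ∀ x, Real.exp (-V x - ‖y - a • x‖ ^ 2 / (2 * γ ^ 2))
        = Real.exp (-V x) * Real.exp (-(‖y - a • x‖ ^ 2 / (2 * γ ^ 2))) := fun x => by
      rw [← Real.exp_add, sub_eq_add_neg]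
    have hinner : ∀ {w : EuclideanSpace ℝ (Fin d) → EuclideanSpace ℝ (Fin d)},
        Integrable (fun x => Real.exp (-V x - ‖y - a • x‖ ^ 2 / (2 * γ ^ 2)) • w x) →
        Integrable fun x => Real.exp (-V x) * Real.exp (-(‖y - a • x‖ ^ 2 / (2 * γ ^ 2))) *
          ⟪w x, v⟫_ℝ := fun h => by
      simpa only [real_inner_smul_left, hsplit] using h.inner_const (𝕜 := ℝ) v
    have hiV := hinner hintV
    have hiY := hinner hintY
    simp only [hsplit] at hint ⊢
    have hA : ∀ x, -(Real.exp (-V x) * Real.exp (-(‖y - a • x‖ ^ 2 / (2 * γ ^ 2))) *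
          ⟪gradient V x, v⟫_ℝ) = ContinuousLinearMap.mul ℝ ℝ
        ((Real.exp (-V x) • -(InnerProductSpace.toDual ℝ _ (gradient V x))) v)
        (Real.exp (-(‖y - a • x‖ ^ 2 / (2 * γ ^ 2)))) := fun x => by
      simp only [ContinuousLinearMap.mul_apply', smul_apply,
        neg_apply, InnerProductSpace.toDual_apply_apply, smul_eq_mul]
      ring
    have hB : ∀ x, -a * (Real.exp (-V x) * Real.exp (-(‖y - a • x‖ ^ 2 / (2 * γ ^ 2))) *
          ⟪(-(1 / γ ^ 2)) • (y - a • x), v⟫_ℝ) = ContinuousLinearMap.mul ℝ ℝ (Real.exp (-V x))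
        ((Real.exp (-(‖y - a • x‖ ^ 2 / (2 * γ ^ 2))) •
          ((-a) • InnerProductSpace.toDual ℝ _ ((-(1 / γ ^ 2)) • (y - a • x)))) v) := fun x => by
      simp only [ContinuousLinearMap.mul_apply', smul_apply,
        InnerProductSpace.toDual_apply_apply, smul_eq_mul]
      ring
    have key := integral_bilinear_hasFDerivAt_right_eq_neg_left_of_integrable
      (μ := (volume : Measure (EuclideanSpace ℝ (Fin d)))) (B := ContinuousLinearMap.mul ℝ ℝ)
      (v := v) (f := fun x => Real.exp (-V x))
      (g := fun x => Real.exp (-(‖y - a • x‖ ^ 2 / (2 * γ ^ 2))))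
      (hiV.neg.congr (Filter.Eventually.of_forall hA))
      ((hiY.const_mul (-a)).congr (Filter.Eventually.of_forall hB))
      hint (fun x _ => hf x) (fun x _ => hg x)
    simp only [← hA, ← hB, integral_const_mul, integral_neg, neg_neg] at key
    rw [← key]
    field_simp
  refine ⟨hint, ?_, hintV, ?_⟩
  · rw [hq y]
    exact integral_exp_pos hint
  · rw [hasGradientAt_iff_hasFDerivAt, funext hq]
    refine hder.congr_fderiv ?_
    ext v
    have hdual := (InnerProductSpace.toDual ℝ
      (EuclideanSpace ℝ (Fin d))).toContinuousLinearEquiv.integrable_comp_iff.2 hintY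
    refine (ContinuousLinearMap.integral_apply hdual v).trans ?_
    rw [InnerProductSpace.toDual_apply_apply, real_inner_smul_left, real_inner_comm,
      ← integral_inner hintV]
    refine (integral_congr_ae (Filter.Eventually.of_forall fun x =>
      real_inner_smul_left _ _ _)).trans ((hibp v).trans ?_)
    simp only [real_inner_smul_right, real_inner_comm v]
end
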